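/- Let G be a finite group and p a prime. If δ₀(G) ≥ 4, then p^6 divides the order of G; and if moreover p = 2 or p = 3, then p^7 divides the order of G. -/

import Mathlib

/-- The `p`-rank of a group `G`: the largest `r` such that `G` contains an
elementary abelian `p`-subgroup of rank `r`, i.e. a subgroup isomorphic to `(ℤ/pℤ)^r`. -/
noncomputable def prank (p : ℕ) (G : Type*) [Group G] : ℕ :=
  sSup {r : ℕ | ∃ H : Subgroup G, Nonempty (↥H ≃* Multiplicative (Fin r → ZMod p))}

theorem bddAbove_elementary_abelian_ranks (p : ℕ) (hp : p.Prime) (G : Type*) [Group G]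
    [Finite G] :
    BddAbove {r : ℕ | ∃ H : Subgroup G, Nonempty (↥H ≃* Multiplicative (Fin r → ZMod p))} := by
  have := Fact.mk hp
  refine ⟨Nat.card G, ?_⟩
  rintro r ⟨H, ⟨e⟩⟩
  have hcard : Nat.card H = p ^ r := by
    rw [Nat.card_congr e.toEquiv, Nat.card_congr Multiplicative.toAdd]
    simp
  exact (Nat.lt_pow_self hp.one_lt).le.trans (hcard ▸ Subgroup.card_le_card_group H)

theorem exists_subgroup_mulEquiv_prank (p : ℕ) (hp : p.Prime) (G : Type*) [Group G]
    [Finite G] :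
    ∃ H : Subgroup G, Nonempty (↥H ≃* Multiplicative (Fin (prank p G) → ZMod p)) := by
  have := Fact.mk hp
  refine Nat.sSup_mem (s := {r : ℕ | ∃ H : Subgroup G,
    Nonempty (↥H ≃* Multiplicative (Fin r → ZMod p))}) ⟨0, ⊥, ?_⟩
    (bddAbove_elementary_abelian_ranks p hp G)
  have : Unique (Multiplicative (Fin 0 → ZMod p)) :=
    inferInstanceAs (Unique (Fin 0 → ZMod p))
  exact ⟨MulEquiv.ofUnique⟩

theorem card_le_pow_prank {p : ℕ} (hp : p.Prime) {A G : Type*} [CommGroup A] [Group G]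
    [Finite G] (hA : ∀ a : A, a ^ p = 1) (i : A →* G) (hi : Function.Injective i) :
    Nat.card A ≤ p ^ prank p G := by
  have := Fact.mk hp
  have : Finite A := Finite.of_injective i hi
  let : Module (ZMod p) (Additive A) := AddCommGroup.zmodModule (n := p) fun a => hA a.toMul
  have b := Module.finBasis (ZMod p) (Additive A)
  set k := Module.finrank (ZMod p) (Additive A)
  have e : A ≃* Multiplicative (Fin k → ZMod p) :=
    AddEquiv.toMultiplicativeRight b.equivFun.toAddEquiv
  have hk : k ≤ prank p G :=
    le_csSup (bddAbove_elementary_abelian_ranks p hp G)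
      ⟨i.range, ⟨(MonoidHom.ofInjective hi).symm.trans e⟩⟩
  have hcard : Nat.card A = p ^ k := by
    rw [Nat.card_congr e.toEquiv, Nat.card_congr Multiplicative.toAdd]
    simp
  exact hcard ▸ Nat.pow_le_pow_right hp.pos hk

theorem Subgroup.card_le_card_ker_mul_card_map {A B : Type*} [Group A] [Group B] [Finite A]
    (g : A →* B) (K : Subgroup A) :
    Nat.card K ≤ Nat.card g.ker * Nat.card (K.map g) := by
  have h := (g.domRestrict K).ker.card_mul_index
  rw [Subgroup.index_ker, MonoidHom.domRestrict_range] at h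
  rw [← h]
  refine Nat.mul_le_mul_right _ ?_
  refine Nat.card_le_card_of_injective
    (fun x : (g.domRestrict K).ker => (⟨x.1.1, x.2⟩ : g.ker)) fun x y hxy => ?_
  exact Subtype.ext (Subtype.ext (congrArg g.ker.subtype hxy))

theorem MonoidHom.card_le_card_ker_pow_three {A : Type*} [Group A] [Finite A] (f : A →* A)
    (hf : ∀ a, f (f (f a)) = 1) : Nat.card A ≤ Nat.card f.ker ^ 3 := by
  have h1 := Subgroup.card_le_card_ker_mul_card_map f ⊤
  have h2 := Subgroup.card_le_card_ker_mul_card_map f ((⊤ : Subgroup A).map f)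
  have h3 : Nat.card (((⊤ : Subgroup A).map f).map f) ≤ Nat.card f.ker := by
    refine Subgroup.card_le_of_le ?_
    rintro _ ⟨_, ⟨a, -, rfl⟩, rfl⟩
    exact hf a
  rw [Subgroup.card_top] at h1
  calc Nat.card A ≤ _ := h1
    _ ≤ _ := Nat.mul_le_mul_left _ (h2.trans (Nat.mul_le_mul_left _ h3))
    _ = _ := by ring

theorem MonoidHom.div_id_iterate_three_eq_one {A : Type*} [CommGroup A] {p : ℕ}
    (hp : p = 2 ∨ p = 3) (hA : ∀ a : A, a ^ p = 1) (φ : A →* A) (hφ : ∀ a, φ^[p] a = a)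
    (a : A) :
    (φ / MonoidHom.id A) ((φ / MonoidHom.id A) ((φ / MonoidHom.id A) a)) = 1 := by
  rcases hp with rfl | rfl
  · have key : ∀ b, (φ / MonoidHom.id A) ((φ / MonoidHom.id A) b) = 1 := by
      intro b
      have h2 : φ (φ b) = b := hφ b
      simp only [MonoidHom.div_apply, MonoidHom.id_apply, map_div, h2]
      calc b / φ b / (φ b / b) = b ^ 2 / (φ b) ^ 2 := by
            rw [div_div_div_eq, pow_two, pow_two]
        _ = 1 := by rw [hA, hA, div_one]
    exact key _
  · have h3 : φ (φ (φ a)) = a := hφ a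
    simp only [MonoidHom.div_apply, MonoidHom.id_apply, map_div, h3]
    calc _ = (φ a) ^ 3 / (φ (φ a)) ^ 3 := by
          rw [← div_eq_one]
          simp only [div_eq_mul_inv, mul_inv_rev, inv_inv]
          generalize φ (φ a) = x
          generalize φ a = y
          apply Additive.ofMul.injective
          simp only [ofMul_mul, ofMul_inv, ofMul_pow, ofMul_one]
          abel
      _ = 1 := by rw [hA, hA, div_one]

theorem Sylow.exists_subgroup_mulEquiv_prank {G : Type*} [Group G] [Finite G] {p : ℕ}
    (hp : p.Prime) (S : Sylow p G) :
    ∃ H : Subgroup S, Nonempty (↥H ≃* Multiplicative (Fin (prank p G) → ZMod p)) := by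
  have := Fact.mk hp
  obtain ⟨E, ⟨e⟩⟩ := _root_.exists_subgroup_mulEquiv_prank p hp G
  have hE : IsPGroup p E := by
    refine IsPGroup.of_card (n := prank p G) ?_
    rw [Nat.card_congr e.toEquiv, Nat.card_congr Multiplicative.toAdd]
    simp
  obtain ⟨T, hT⟩ := hE.exists_le_sylow
  let c := Sylow.equiv T S
  refine ⟨(E.subgroupOf T).map (c : T →* S), ⟨?_⟩⟩
  exact ((Subgroup.equivMapOfInjective _ (c : T →* S) c.injective).symm.trans
    (Subgroup.subgroupOfEquivOfLe hT)).trans e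

open scoped IsMulCommutative in
theorem IsPGroup.one_le_prank_center {p : ℕ} (hp : p.Prime) {P : Type*} [Group P] [Finite P]
    [Nontrivial P] (hP : IsPGroup p P) : 1 ≤ prank p (Subgroup.center P) := by
  have := Fact.mk hp
  have := hP.center_nontrivial
  have hZ : IsPGroup p (Subgroup.center P) := hP.to_subgroup _
  obtain ⟨n, hn, hc⟩ := hZ.nontrivial_iff_card.mp inferInstance
  obtain ⟨z, hz⟩ := exists_prime_orderOf_dvd_card' (G := Subgroup.center P) p
    (hc ▸ dvd_pow_self p hn.ne')
  have h := card_le_pow_prank hp (A := Subgroup.zpowers z) (fun a => by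
    have := pow_card_eq_one' (x := a)
    rwa [Nat.card_zpowers, hz] at this) (Subgroup.zpowers z).subtype Subtype.val_injective
  rw [Nat.card_zpowers, hz] at h
  by_contra h0
  have h0 : prank p (Subgroup.center P) = 0 := by omega
  rw [h0, pow_zero] at h
  exact absurd hp.one_lt (by omega)

open scoped IsMulCommutative in
theorem card_le_pow_prank_center_pow_three {p : ℕ} (hp : p.Prime) (hp23 : p = 2 ∨ p = 3)
    {P : Type*} [Group P] [Finite P] (E : Subgroup P) [E.Normal] [IsMulCommutative E]
    (hE : ∀ a : E, a ^ p = 1) (hindex : E.index = p) :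
    Nat.card E ≤ (p ^ prank p (Subgroup.center P)) ^ 3 := by
  obtain ⟨s, hs⟩ : ∃ s, s ∉ E := by
    by_contra! h
    rw [(Subgroup.eq_top_iff' E).mpr h, Subgroup.index_top] at hindex
    exact hp.one_lt.ne hindex
  let φ : E →* E := (MulAut.conjNormal s : MulAut E).toMonoidHom
  have hφ : ∀ a, ((φ a : E) : P) = s * a * s⁻¹ := fun a => MulAut.conjNormal_apply s a
  have hiter : ∀ n a, ((φ^[n] a : E) : P) = s ^ n * a * (s ^ n)⁻¹ := by
    intro n a
    induction n with
    | zero => simp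
    | succ n ih =>
      rw [Function.iterate_succ_apply', hφ, ih, pow_succ']
      group
  have hsp : s ^ p ∈ E := hindex ▸ E.pow_index_mem s
  have hφp : ∀ a, φ^[p] a = a := by
    intro a
    apply Subtype.ext
    rw [hiter]
    have : s ^ p * (a : P) = a * s ^ p :=
      congrArg Subtype.val (mul_comm (⟨s ^ p, hsp⟩ : E) a)
    rw [this, mul_inv_cancel_right]
  let f : E →* E := φ / MonoidHom.id E
  have hf := f.card_le_card_ker_pow_three
    (MonoidHom.div_id_iterate_three_eq_one hp23 hE φ hφp)
  refine hf.trans (Nat.pow_le_pow_left ?_ 3)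
  have hcentral : ∀ a : f.ker, ((a : E) : P) ∈ Subgroup.center P := by
    rintro ⟨a, ha⟩
    have ha' : φ a = a := div_eq_one.mp ha
    have hcomm : s * (a : P) = a * s := by
      have := congrArg Subtype.val ha'
      rw [hφ] at this
      exact mul_inv_eq_iff_eq_mul.mp this
    have hEC : E ≤ Subgroup.centralizer {(a : P)} := by
      intro x hx
      rw [Subgroup.mem_centralizer_singleton_iff]
      exact congrArg Subtype.val (mul_comm (⟨x, hx⟩ : E) a)
    have hsC : s ∈ Subgroup.centralizer {(a : P)} := by
      rw [Subgroup.mem_centralizer_singleton_iff]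
      exact hcomm
    have htop : Subgroup.centralizer {(a : P)} = ⊤ := by
      rw [← Subgroup.index_eq_one]
      refine ((Nat.dvd_prime hp).mp (hindex ▸ Subgroup.index_dvd_of_le hEC)).resolve_right ?_
      intro h
      have hrel := Subgroup.relIndex_mul_index hEC
      rw [h, hindex] at hrel
      have : E.relIndex (Subgroup.centralizer {(a : P)}) = 1 :=
        Nat.eq_of_mul_eq_mul_right hp.pos (by rw [hrel, one_mul])
      exact hs (Subgroup.relIndex_eq_one.mp this hsC)
    rw [Subgroup.mem_center_iff]
    intro g
    exact Subgroup.mem_centralizer_singleton_iff.mp (htop ▸ Subgroup.mem_top g)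
  refine card_le_pow_prank hp (fun a => Subtype.ext (hE a))
    ((E.subtype.comp f.ker.subtype).codRestrict (Subgroup.center P) hcentral) ?_
  intro a b hab
  exact Subtype.ext (Subtype.ext (congrArg (Subgroup.center P).subtype hab))

open scoped IsMulCommutative in
theorem card_le_pow_prank_center_of_eq_top {p : ℕ} (hp : p.Prime) {P : Type*} [Group P]
    [Finite P] {E : Subgroup P} [IsMulCommutative E] (hE : ∀ a : E, a ^ p = 1)
    (htop : E = ⊤) : Nat.card E ≤ p ^ prank p (Subgroup.center P) := by
  have hmem : ∀ a : E, (a : P) ∈ Subgroup.center P := by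
    intro a
    rw [Subgroup.mem_center_iff]
    intro g
    exact congrArg Subtype.val (mul_comm (⟨g, htop ▸ Subgroup.mem_top g⟩ : E) a)
  exact card_le_pow_prank hp hE (E.subtype.codRestrict (Subgroup.center P) hmem)
    fun a b hab => Subtype.ext (congrArg (Subgroup.center P).subtype hab)

theorem stmt11 {G : Type*} [Group G] [Finite G] (p : ℕ) (hp : p.Prime)
    (S : Sylow p G)
    (hδ : 4 ≤ prank p G - prank p ↥(Subgroup.center ↥(S : Subgroup G))) :
    p ^ 6 ∣ Nat.card G ∧ ((p = 2 ∨ p = 3) → p ^ 7 ∣ Nat.card G) := by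
  have := Fact.mk hp
  obtain ⟨E, ⟨e⟩⟩ := S.exists_subgroup_mulEquiv_prank hp
  have hEcard : Nat.card E = p ^ prank p G := by
    rw [Nat.card_congr e.toEquiv, Nat.card_congr Multiplicative.toAdd]
    simp
  have hEpow : ∀ a : E, a ^ p = 1 := by
    intro a
    apply e.injective
    rw [map_pow, map_one]
    apply Multiplicative.toAdd.injective
    rw [toAdd_pow, toAdd_one]
    ext i
    simp
  have : IsMulCommutative E :=
    ⟨⟨fun a b => e.injective (by rw [map_mul, map_mul, mul_comm])⟩⟩
  obtain ⟨n, hn⟩ := S.isPGroup'.exists_card_eq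
  have hdvd : p ^ n ∣ Nat.card G := hn ▸ Subgroup.card_subgroup_dvd_card (S : Subgroup G)
  have hrn : prank p G ≤ n := by
    have := Subgroup.card_le_card_group E
    rw [hEcard, hn] at this
    exact (Nat.pow_le_pow_iff_right hp.one_lt).mp this
  have : Nontrivial (S : Subgroup G) := by
    rw [← Finite.one_lt_card_iff_nontrivial, hn]
    exact Nat.one_lt_pow (by omega) hp.one_lt
  have hz := S.isPGroup'.one_le_prank_center hp
  have hlt : prank p G < n := by
    refine lt_of_le_of_ne hrn fun h => ?_
    have htop : E = ⊤ := Subgroup.eq_top_of_card_eq E (by rw [hEcard, hn, h])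
    have := card_le_pow_prank_center_of_eq_top hp hEpow htop
    rw [hEcard, Nat.pow_le_pow_iff_right hp.one_lt] at this
    omega
  refine ⟨(pow_dvd_pow p (by omega)).trans hdvd, fun hp23 => ?_⟩
  refine (pow_dvd_pow p ?_).trans hdvd
  by_contra hn7
  have hindex : E.index = p := by
    have h := E.card_mul_index
    rw [hEcard, hn, show n = prank p G + 1 by omega, pow_succ] at h
    exact Nat.eq_of_mul_eq_mul_left (pow_pos hp.pos _) h
  have : E.Normal := by
    refine Subgroup.normal_of_index_eq_minFac_card ?_
    rw [hindex, hn, Nat.Prime.pow_minFac hp (by omega)]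
  have := card_le_pow_prank_center_pow_three hp hp23 E hEpow hindex
  rw [hEcard, ← pow_mul, Nat.pow_le_pow_iff_right hp.one_lt] at this
  omega
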